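/- Let D ≥ 1 and ζ, λ > 0. Let X be an ℝ^D-valued random vector distributed as N(0, ζ² I_D), and let N be any ℝ^D-valued random vector independent of X with finite second moments and Tr Cov(N) ≤ Dλ². Then I(X; X + N) ≥ (D/2)·ln(1 + ζ²/λ²) nats; i.e., among all noise laws with total power at most Dλ², the isotropic Gaussian noise N(0, λ² I_D) minimizes the information leakage about a Gaussian source. -/

import Mathlib

open Finset MeasureTheory ProbabilityTheory Real
open scoped NNReal ENNReal Classical

/-- The Kullback–Leibler divergence `KL(μ ‖ ν)`, in nats, valued in `EReal`. -/
noncomputable def klDiv {α : Type*} [MeasurableSpace α] (μ ν : Measure α) : EReal :=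
  if μ ≪ ν ∧ Integrable (llr μ ν) μ then ((∫ x, llr μ ν x ∂μ : ℝ) : EReal) else ⊤

/-- The mutual information of a joint law `ρ` on `α × β`, in nats. -/
noncomputable def mutualInfo {α β : Type*} [MeasurableSpace α] [MeasurableSpace β]
    (ρ : Measure (α × β)) : EReal :=
  klDiv ρ ((ρ.map Prod.fst).prod (ρ.map Prod.snd))

/-- The isotropic Gaussian measure `N(u, v I_D)` on `ℝ^D`. -/
noncomputable def gaussianPi (D : ℕ) (u : Fin D → ℝ) (v : ℝ≥0) : Measure (Fin D → ℝ) :=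
  Measure.pi fun d => gaussianReal (u d) v

/-- The isotropic Gaussian measure is a probability measure. -/
instance isProbabilityMeasure_gaussianPi (D : ℕ) (u : Fin D → ℝ) (v : ℝ≥0) :
    IsProbabilityMeasure (gaussianPi D u v) := by
  unfold gaussianPi
  infer_instance

/-- The Donsker–Varadhan lower bound for the log-likelihood ratio, with a normalized exponential. -/
lemma integral_le_integral_llr {α : Type*} [MeasurableSpace α] {μ ν : Measure α}
    [IsProbabilityMeasure μ] [IsProbabilityMeasure ν] (hμν : μ ≪ ν)
    (h_int : Integrable (llr μ ν) μ) {f : α → ℝ} (hfμ : Integrable f μ)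
    (hfν : ∫ x, exp (f x) ∂ν = 1) :
    ∫ x, f x ∂μ ≤ ∫ x, llr μ ν x ∂μ := by
  have hexp : Integrable (fun x => exp (f x)) ν := .of_integral_ne_zero (by simp [hfν])
  have := isProbabilityMeasure_tilted hexp
  have h := InformationTheory.integral_llr_add_sub_measure_univ_nonneg
    (hμν.trans (absolutelyContinuous_tilted hexp))
    (integrable_llr_tilted_right hμν hfμ h_int hexp)
  rw [integral_llr_tilted_right hμν hfμ hexp h_int, hfν] at h
  simp only [log_one, probReal_univ] at h
  linarith

/-- The log-density of `N(b, s)` with respect to `N(0, v)`. -/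
noncomputable def gaussianLogRatio (v s b x : ℝ) : ℝ :=
  1 / 2 * log (v / s) - (x - b) ^ 2 / (2 * s) + x ^ 2 / (2 * v)

lemma gaussianPDFReal_mul_exp_gaussianLogRatio {v s : ℝ≥0} (hv : v ≠ 0) (hs : s ≠ 0) (b x : ℝ) :
    gaussianPDFReal 0 v x * exp (gaussianLogRatio v s b x) = gaussianPDFReal b s x := by
  have hv' : (0 : ℝ) < v := by positivity
  have hs' : (0 : ℝ) < s := by positivity
  have hsqrt : exp (1 / 2 * log ((v : ℝ) / s)) = √((v : ℝ) / s) := by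
    rw [sqrt_eq_rpow, rpow_def_of_pos (by positivity), mul_comm]
  have hcoef : (√(2 * π * v))⁻¹ * √((v : ℝ) / s) = (√(2 * π * s))⁻¹ := by
    rw [← sqrt_inv, ← sqrt_inv, ← sqrt_mul (by positivity)]
    congr 1
    field_simp
  rw [gaussianPDFReal, gaussianPDFReal, ← hcoef, ← hsqrt, mul_assoc (√(2 * π * v))⁻¹,
    mul_assoc (√(2 * π * v))⁻¹, ← exp_add, ← exp_add, gaussianLogRatio]
  congr 2
  ring

lemma integral_exp_gaussianLogRatio {v s : ℝ≥0} (hv : v ≠ 0) (hs : s ≠ 0) (b : ℝ) :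
    ∫ x, exp (gaussianLogRatio v s b x) ∂(gaussianReal 0 v) = 1 := by
  simp_rw [integral_gaussianReal_eq_integral_smul hv, smul_eq_mul,
    gaussianPDFReal_mul_exp_gaussianLogRatio hv hs]
  exact integral_gaussianPDFReal_eq_one b hs

lemma integral_exp_sum_gaussianLogRatio {D : ℕ} {v s : ℝ≥0} (hv : v ≠ 0) (hs : s ≠ 0)
    (b : Fin D → ℝ) :
    ∫ x, exp (∑ d, gaussianLogRatio v s (b d) (x d)) ∂(gaussianPi D 0 v) = 1 := by
  simp_rw [exp_sum, gaussianPi, Pi.zero_apply]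
  rw [integral_fintype_prod_eq_prod (fun d x => exp (gaussianLogRatio v s (b d) x))]
  simp [integral_exp_gaussianLogRatio hv hs]

/-- A Gaussian log-density ratio whose mean is a measurable function of an independent variable
has normalized exponential. -/
lemma integral_exp_sum_gaussianLogRatio_prod {D : ℕ} {β : Type*} [MeasurableSpace β] {v s : ℝ≥0}
    (hv : v ≠ 0) (hs : s ≠ 0) {b : β → Fin D → ℝ} (hb : Measurable b) (ν : Measure β)
    [IsProbabilityMeasure ν] :
    ∫ p : (Fin D → ℝ) × β, exp (∑ d, gaussianLogRatio v s (b p.2 d) (p.1 d))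
      ∂((gaussianPi D 0 v).prod ν) = 1 := by
  have hmeas : Measurable fun p : (Fin D → ℝ) × β =>
      exp (∑ d, gaussianLogRatio v s (b p.2 d) (p.1 d)) := by
    unfold gaussianLogRatio
    fun_prop
  rw [integral_prod_symm]
  · simp [integral_exp_sum_gaussianLogRatio hv hs]
  · rw [integrable_prod_iff' hmeas.aestronglyMeasurable]
    refine ⟨.of_forall fun y => .of_integral_ne_zero ?_, ?_⟩
    · simp [integral_exp_sum_gaussianLogRatio hv hs]
    · simp [integral_exp_sum_gaussianLogRatio hv hs]

/-- The mean square error of the linear estimator of a centered variable from its sum with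
an independent noise. -/
lemma integral_sq_sub_linear_estimate {Ω : Type*} [MeasurableSpace Ω] {P : Measure Ω}
    [IsProbabilityMeasure P] {U V : Ω → ℝ} (hU : MemLp U 2 P) (hV : MemLp V 2 P)
    (hUV : IndepFun U V P) (hU0 : P[U] = 0) (a : ℝ) :
    ∫ ω, (U ω - a * (U ω + V ω - P[V])) ^ 2 ∂P
      = (1 - a) ^ 2 * Var[U; P] + a ^ 2 * Var[V; P] := by
  have hU1 : MemLp (fun ω => (1 - a) * U ω) 2 P := hU.const_mul _
  have hV1 : MemLp (fun ω => -a * V ω) 2 P := hV.const_mul _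
  have hind : IndepFun (fun ω => (1 - a) * U ω) (fun ω => -a * V ω) P :=
    hUV.comp (measurable_const_mul (1 - a)) (measurable_const_mul (-a))
  have h := hind.variance_add hU1 hV1
  rw [variance_const_mul, variance_const_mul, neg_sq] at h
  rw [← h, variance_eq_integral (hU1.add hV1).aemeasurable]
  have hmean : P[(fun ω => (1 - a) * U ω) + fun ω => -a * V ω] = -a * P[V] := by
    simp only [Pi.add_apply]
    rw [integral_add (hU1.integrable one_le_two) (hV1.integrable one_le_two), integral_const_mul,
      integral_const_mul, hU0]
    ring
  rw [hmean]
  congr with ω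
  simp only [Pi.add_apply]
  ring

/-- The expected log-likelihood ratio of the linear Gaussian backward channel. -/
lemma integrable_and_integral_gaussianLogRatio {Ω : Type*} [MeasurableSpace Ω] {P : Measure Ω}
    [IsProbabilityMeasure P] {U V : Ω → ℝ} (hU : MemLp U 2 P) (hV : MemLp V 2 P)
    (hUV : IndepFun U V P) (hU0 : P[U] = 0) (a v s : ℝ) :
    Integrable (fun ω => gaussianLogRatio v s (a * (U ω + V ω - P[V])) (U ω)) P ∧
    ∫ ω, gaussianLogRatio v s (a * (U ω + V ω - P[V])) (U ω) ∂P
      = 1 / 2 * log (v / s) - ((1 - a) ^ 2 * Var[U; P] + a ^ 2 * Var[V; P]) / (2 * s)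
        + Var[U; P] / (2 * v) := by
  have hcentered : MemLp (fun ω => U ω + V ω - P[V]) 2 P := (hU.add hV).sub (memLp_const _)
  have herr : MemLp (fun ω => U ω - a * (U ω + V ω - P[V])) 2 P :=
    hU.sub (hcentered.const_mul a)
  have hsq := herr.integrable_sq
  have h1 := hsq.div_const (2 * s)
  have h2 := hU.integrable_sq.div_const (2 * v)
  have h3 : Integrable (fun ω => 1 / 2 * log (v / s)
      - (U ω - a * (U ω + V ω - P[V])) ^ 2 / (2 * s)) P := (integrable_const _).sub h1
  refine ⟨h3.add h2, ?_⟩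
  unfold gaussianLogRatio
  rw [integral_add h3 h2, integral_sub (integrable_const _) h1, integral_div, integral_div,
    integral_sq_sub_linear_estimate hU hV hUV hU0, variance_of_integral_eq_zero hU.aemeasurable hU0]
  simp

lemma map_eval_gaussianPi {D : ℕ} (u : Fin D → ℝ) (v : ℝ≥0) (d : Fin D) :
    (gaussianPi D u v).map (fun x => x d) = gaussianReal (u d) v :=
  (measurePreserving_eval (fun d => gaussianReal (u d) v) d).map_eq

/-- **Gaussian noise minimizes leakage about a Gaussian source.**
Let `X ~ N(0, ζ² I_D)` and let `N` be any independent noise with finite second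
moments and `Tr Cov(N) ≤ D λ²`.  Then `I(X; X + N) ≥ (D/2)·ln(1 + ζ²/λ²)` nats. -/
theorem gaussian_noise_minimizes_leakage
    (D : ℕ) (hD : 1 ≤ D) (ζ lam : ℝ) (hζ : 0 < ζ) (hlam : 0 < lam)
    {Ω : Type*} [MeasurableSpace Ω] (P : Measure Ω) [IsProbabilityMeasure P]
    (X N : Ω → Fin D → ℝ) (hX : Measurable X) (hN : Measurable N)
    (hindep : IndepFun X N P)
    (hXlaw : P.map X = gaussianPi D 0 (ζ ^ 2).toNNReal)
    (hNmom : ∀ d, MemLp (fun x : Fin D → ℝ => x d) 2 (P.map N))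
    (hNpow : ∑ d, variance (fun x : Fin D → ℝ => x d) (P.map N) ≤ (D : ℝ) * lam ^ 2) :
    (((D : ℝ) / 2 * Real.log (1 + ζ ^ 2 / lam ^ 2) : ℝ) : EReal) ≤
      mutualInfo (P.map fun ω => (X ω, X ω + N ω)) := by
  have hXN : Measurable fun ω => (X ω, X ω + N ω) := by fun_prop
  have hcoord (d : Fin D) : HasLaw (fun ω => X ω d) (gaussianReal 0 (ζ ^ 2).toNNReal) P := by
    refine ⟨by fun_prop, ?_⟩
    exact (Measure.map_map (measurable_pi_apply d) hX).symm.trans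
      (hXlaw ▸ map_eval_gaussianPi 0 (ζ ^ 2).toNNReal d)
  have hv : ((ζ ^ 2).toNNReal : ℝ) = ζ ^ 2 := coe_toNNReal _ (by positivity)
  have hXL2 (d : Fin D) : MemLp (fun ω => X ω d) 2 P := by
    have h := memLp_id_gaussianReal' (μ := 0) (v := (ζ ^ 2).toNNReal) 2 (by simp)
    rw [← (hcoord d).map_eq] at h
    exact h.comp_of_map (by fun_prop)
  have hX0 (d : Fin D) : P[fun ω => X ω d] = 0 := by
    rw [(hcoord d).integral_eq, integral_id_gaussianReal]
  have hXvar (d : Fin D) : Var[fun ω => X ω d; P] = ζ ^ 2 := by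
    rw [(hcoord d).variance_eq, variance_id_gaussianReal, hv]
  have hNL2 (d : Fin D) : MemLp (fun ω => N ω d) 2 P := (hNmom d).comp_of_map (by fun_prop)
  have hNvar (d : Fin D) :
      Var[fun x : Fin D → ℝ => x d; P.map N] = Var[fun ω => N ω d; P] :=
    variance_map (measurable_pi_apply d).aemeasurable hN.aemeasurable
  have hXNd (d : Fin D) : IndepFun (fun ω => X ω d) (fun ω => N ω d) P :=
    hindep.comp (measurable_pi_apply d) (measurable_pi_apply d)
  simp_rw [hNvar] at hNpow
  set a : ℝ := ζ ^ 2 / (ζ ^ 2 + lam ^ 2) with ha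
  set s : ℝ := ζ ^ 2 * lam ^ 2 / (ζ ^ 2 + lam ^ 2) with hs
  have hspos : 0 < s := by positivity
  have hs' : (s.toNNReal : ℝ) = s := coe_toNNReal _ hspos.le
  have hmse : (1 - a) ^ 2 * ζ ^ 2 + a ^ 2 * lam ^ 2 = s := by
    rw [ha, hs]
    field_simp
    ring
  have hratio : ζ ^ 2 / s = 1 + ζ ^ 2 / lam ^ 2 := by
    rw [hs]
    field_simp
    ring
  let b : (Fin D → ℝ) → Fin D → ℝ := fun y d => a * (y d - P[fun ω => N ω d])
  let f : (Fin D → ℝ) × (Fin D → ℝ) → ℝ :=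
    fun p => ∑ d, gaussianLogRatio (ζ ^ 2) s (b p.2 d) (p.1 d)
  have hb : Measurable b := by fun_prop
  have hf : Measurable f := by
    unfold f gaussianLogRatio
    fun_prop
  have hlog (d : Fin D) :=
    integrable_and_integral_gaussianLogRatio (hXL2 d) (hNL2 d) (hXNd d) (hX0 d) a (ζ ^ 2) s
  have hfint : Integrable f (P.map fun ω => (X ω, X ω + N ω)) := by
    rw [integrable_map_measure hf.aestronglyMeasurable hXN.aemeasurable]
    exact integrable_finsetSum _ fun d _ => (hlog d).1
  have hfval : (D : ℝ) / 2 * log (1 + ζ ^ 2 / lam ^ 2)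
      ≤ ∫ p, f p ∂(P.map fun ω => (X ω, X ω + N ω)) := by
    rw [integral_map hXN.aemeasurable hf.aestronglyMeasurable]
    have hsum : ∫ ω, f (X ω, X ω + N ω) ∂P = ∑ d : Fin D, (1 / 2 * log (ζ ^ 2 / s)
        - ((1 - a) ^ 2 * ζ ^ 2 + a ^ 2 * Var[fun ω => N ω d; P]) / (2 * s)
        + ζ ^ 2 / (2 * ζ ^ 2)) := by
      refine (integral_finsetSum _ fun d _ => (hlog d).1).trans (Finset.sum_congr rfl fun d _ => ?_)
      rw [(hlog d).2, hXvar]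
    rw [hsum, Finset.sum_add_distrib, Finset.sum_sub_distrib, ← Finset.sum_div,
      Finset.sum_add_distrib, ← Finset.mul_sum _ _ (a ^ 2), hratio]
    simp only [Finset.sum_const, Finset.card_univ, Fintype.card_fin, nsmul_eq_mul]
    have hle : (D * ((1 - a) ^ 2 * ζ ^ 2) + a ^ 2 * ∑ d, Var[fun ω => N ω d; P]) / (2 * s)
        ≤ D / 2 := by
      rw [div_le_div_iff₀ (by positivity) two_pos]
      nlinarith [mul_le_mul_of_nonneg_left hNpow (sq_nonneg a)]
    have hhalf : ζ ^ 2 / (2 * ζ ^ 2) = 1 / 2 := by field_simp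
    rw [hhalf]
    linarith
  have hfst : (P.map fun ω => (X ω, X ω + N ω)).map Prod.fst = gaussianPi D 0 (ζ ^ 2).toNNReal := by
    rw [Measure.map_map measurable_fst hXN, ← hXlaw]
    rfl
  have := Measure.isProbabilityMeasure_map (μ := P) hXN.aemeasurable
  have := Measure.isProbabilityMeasure_map (μ := P.map fun ω => (X ω, X ω + N ω))
    measurable_snd.aemeasurable
  rw [mutualInfo, hfst, klDiv]
  split_ifs with h
  · refine EReal.coe_le_coe_iff.2 (hfval.trans (integral_le_integral_llr h.1 h.2 hfint ?_))
    have hexp := integral_exp_sum_gaussianLogRatio_prod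
      (v := (ζ ^ 2).toNNReal) (s := s.toNNReal) (by positivity) (by positivity) hb
      ((P.map fun ω => (X ω, X ω + N ω)).map Prod.snd)
    rwa [hv, hs'] at hexp
  · exact le_top
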